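/- arXiv:2112.13685 — 2 statements merged into one kernel-verified Lean document; each statement's English description precedes it below -/
import Mathlib

section
/- (Steinberg–Serre) A vector v ∈ V has nontrivial stabilizer in W if and only if v lies in a reflecting hyperplane, i.e. V_reg = V ∖ ⋃_{s ∈ Ref(W)} V^s. In particular, if v ∈ V is fixed by no reflection of W, then the stabilizer of v in W is trivial. -/
open Module

noncomputable section

variable {V : Type*} [AddCommGroup V] [Module ℂ V] [FiniteDimensional ℂ V]

/-- `g` is a reflection: its fixed-point subspace has codimension 1. -/
def IsReflection (g : V ≃ₗ[ℂ] V) : Prop :=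
  finrank ℂ (LinearMap.ker ((g : V →ₗ[ℂ] V) - LinearMap.id)) + 1 = finrank ℂ V

/-- The set of points of `V` with trivial stabilizer in `W`. -/
def VReg (W : Subgroup (V ≃ₗ[ℂ] V)) : Set V :=
  {v | ∀ w ∈ W, w v = v → w = 1}

universe u

open TensorProduct in
theorem maximalIdeal_rTensor_localizedModule_injective {R M : Type*} [CommRing R]
    [AddCommGroup M] [Module R M] (p : Ideal R) [p.IsPrime] (a : R) (ha : a ∉ p)
    (h : ∀ k : p ⊗[R] M, p.subtype.rTensor M k = 0 → a • k = 0) :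
    Function.Injective ((IsLocalRing.maximalIdeal (Localization.AtPrime p)).subtype.rTensor
      (LocalizedModule p.primeCompl M)) := by
  set Rp := Localization.AtPrime p
  set Mp := LocalizedModule p.primeCompl M
  set f : M →ₗ[R] Mp := LocalizedModule.mkLinearMap p.primeCompl M
  set 𝔪 := IsLocalRing.maximalIdeal Rp
  let g : p →ₗ[R] 𝔪 :=
    { toFun := fun x => ⟨algebraMap R Rp x,
        (IsLocalization.AtPrime.to_map_mem_maximal_iff Rp p x).2 x.2⟩
      map_add' := fun x y => by ext; simp
      map_smul' := fun r x => by ext; simp [Algebra.smul_def] }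
  let φ : p ⊗[R] M →ₗ[R] 𝔪 ⊗[Rp] Mp :=
    TensorProduct.lift (LinearMap.mk₂ R (fun x y => g x ⊗ₜ[Rp] f y)
      (fun x y z => by rw [map_add, TensorProduct.add_tmul])
      (fun r x y => by rw [map_smul, TensorProduct.smul_tmul'])
      (fun x y z => by rw [map_add, TensorProduct.tmul_add])
      (fun r x y => by rw [map_smul, TensorProduct.tmul_smul]))
  have hφ : ∀ x y, φ (x ⊗ₜ y) = g x ⊗ₜ[Rp] f y := fun x y => rfl
  have hφ' : ∀ k, TensorProduct.lid Rp Mp (𝔪.subtype.rTensor Mp (φ k)) =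
      f (TensorProduct.lid R M (p.subtype.rTensor M k)) := by
    intro k
    induction k with
    | zero => simp
    | add x y hx hy => simp only [map_add, hx, hy]
    | tmul x y =>
      rw [hφ]
      simp [g, algebraMap_smul]
  have hsurj : ∀ z : 𝔪 ⊗[Rp] Mp, ∃ t ∈ p.primeCompl, ∃ k, t • z = φ k := by
    intro z
    induction z with
    | zero => exact ⟨1, one_mem _, 0, by simp⟩
    | add x y hx hy =>
      obtain ⟨t, ht, k, hk⟩ := hx
      obtain ⟨t', ht', k', hk'⟩ := hy
      refine ⟨t * t', mul_mem ht ht', t' • k + t • k', ?_⟩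
      rw [map_add, map_smul, map_smul, ← hk, ← hk', smul_add, smul_smul, smul_smul, mul_comm t']
    | tmul x y =>
      obtain ⟨⟨i, s⟩, hi⟩ := IsLocalization.surj p.primeCompl (x : Rp)
      obtain ⟨⟨y₀, s'⟩, hy⟩ := IsLocalizedModule.surj p.primeCompl f y
      have hip : i ∈ p := by
        rw [← IsLocalization.AtPrime.to_map_mem_maximal_iff Rp p i]
        simp only at hi
        rw [← hi]
        exact Ideal.mul_mem_right _ _ x.2
      refine ⟨s * s', mul_mem s.2 s'.2, ⟨i, hip⟩ ⊗ₜ y₀, ?_⟩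
      rw [hφ, mul_smul, ← TensorProduct.tmul_smul, TensorProduct.smul_tmul']
      congr 1
      · ext
        simp only [g, LinearMap.coe_mk, AddHom.coe_mk]
        rw [← hi, mul_comm]
        simp [Algebra.smul_def]
  have hunit : ∀ t ∈ p.primeCompl, ∀ z : 𝔪 ⊗[Rp] Mp, t • z = 0 → z = 0 := by
    intro t ht z hz
    rw [← algebraMap_smul Rp] at hz
    exact (IsLocalization.map_units Rp (⟨t, ht⟩ : p.primeCompl)).smul_eq_zero.1 hz
  rw [injective_iff_map_eq_zero]
  intro z hz
  obtain ⟨t, ht, k, hk⟩ := hsurj z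
  have h1 : f (TensorProduct.lid R M (p.subtype.rTensor M k)) = 0 := by
    rw [← hφ', ← hk, ← algebraMap_smul Rp, map_smul, hz]; simp
  obtain ⟨u, hu⟩ := (IsLocalizedModule.eq_zero_iff p.primeCompl f).1 h1
  have h2 : p.subtype.rTensor M ((u : R) • k) = 0 := by
    apply (TensorProduct.lid R M).injective
    rw [map_smul, map_smul, map_zero]; exact hu
  have h3 := congrArg φ (h _ h2)
  rw [map_smul, map_smul, ← hk, map_zero] at h3
  exact hunit _ ht _ (hunit _ u.2 _ (hunit _ ha _ h3))

open TensorProduct in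
/-- If `p ⊗ M → M` is injective up to an element outside `p`, then `M` has a finite free
submodule whose quotient is supported away from `p`. -/
theorem exists_linearIndependent_of_rTensor_ker {R M : Type u} [CommRing R] [IsDomain R]
    [IsNoetherianRing R] [AddCommGroup M] [Module R M] [Module.Finite R M]
    (p : Ideal R) [p.IsPrime] (a : R) (ha : a ∉ p)
    (h : ∀ k : p ⊗[R] M, p.subtype.rTensor M k = 0 → a • k = 0) :
    ∃ (n : ℕ) (e : Fin n → M), LinearIndependent R e ∧
      ∀ y, ∃ t ∉ p, t • y ∈ Submodule.span R (Set.range e) := by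
  set Rp := Localization.AtPrime p
  set Mp := LocalizedModule p.primeCompl M
  set f : M →ₗ[R] Mp := LocalizedModule.mkLinearMap p.primeCompl M
  have : Module.FinitePresentation R M := Module.finitePresentation_of_finite R M
  have hspan : Submodule.span Rp (Set.range f) = ⊤ := by
    have := span_eq_top_of_isLocalizedModule Rp p.primeCompl f (v := Set.univ) (by simp)
    rwa [Set.image_univ] at this
  obtain ⟨κ, c, b, hb⟩ := exists_basis_of_span_of_maximalIdeal_rTensor_injective
    (maximalIdeal_rTensor_localizedModule_injective p a ha h) f hspan
  have : Finite κ := Module.Finite.finite_basis b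
  obtain ⟨n, ⟨σ⟩⟩ := Finite.exists_equiv_fin κ
  have hli : LinearIndependent R (fun i => c i) := by
    have h1 : LinearIndependent R b := b.linearIndependent.restrict_scalars <| by
      have := IsLocalization.injective Rp p.primeCompl_le_nonZeroDivisors
      simpa [Algebra.smul_def] using this
    refine LinearIndependent.of_comp f ?_
    convert h1 using 1
    ext i
    simp [hb]
  refine ⟨n, fun i => c (σ.symm i), hli.comp _ σ.symm.injective, fun y => ?_⟩
  have hy : f y ∈ Submodule.span Rp (f '' Set.range c) := by
    rw [← Set.range_comp]
    have : f ∘ c = b := by ext i; simp [hb]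
    rw [this, b.span_eq]; trivial
  rw [← Submodule.localized'_span Rp p.primeCompl f, Submodule.mem_localized'] at hy
  obtain ⟨m, hm, s, hs⟩ := hy
  rw [IsLocalizedModule.mk'_eq_iff, ← LinearMap.map_smul_of_tower] at hs
  obtain ⟨u, hu⟩ := (IsLocalizedModule.eq_iff_exists p.primeCompl f).1 hs
  refine ⟨u * s, mul_mem u.2 s.2, ?_⟩
  have hr : Set.range (fun i => c (σ.symm i)) = Set.range c := σ.symm.surjective.range_comp c
  rw [hr, mul_smul]
  have := Submodule.smul_mem _ (u : R) hm
  change (u : R) • m = (u : R) • (s : R) • y at hu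
  rwa [hu] at this

open TensorProduct in
/-- For a group generated by generalised reflections the module of relations of `S` over its
invariants supported at the fixed point `𝔫` is killed by an invariant outside `𝔫`. -/
theorem exists_smul_ker_rTensor_eq_zero {A S G : Type*} [CommRing A] [CommRing S] [Algebra A S]
    [Group G] [Finite G] [MulSemiringAction G S] [SMulCommClass G A S] [Algebra.IsInvariant A S G]
    [IsNoetherianRing A] [IsNoetherianRing S] [FaithfulSMul A S]
    (hG : IsUnit (Nat.card G : S)) (𝔫 : Ideal S) (h1 : 𝔫 ≠ ⊤) (h𝔫 : ∀ g : G, ∀ f ∈ 𝔫, g • f ∈ 𝔫)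
    (T : Set G) (hT : Subgroup.closure T = ⊤)
    (hΔ : ∀ g ∈ T, ∃ α ∈ 𝔫, ∃ Δ : S →ₗ[A] S, ∀ f, g • f = f - α * Δ f) :
    ∃ a : A, a ∉ 𝔫.under A ∧
      ∀ k : (𝔫.under A) ⊗[A] S, (𝔫.under A).subtype.rTensor S k = 0 → a • k = 0 := by
  classical
  have := Fintype.ofFinite G
  set m := 𝔫.under A
  let ι : (S ⊗[A] m) →ₗ[S] S ⊗[A] A := m.subtype.baseChange S
  let K : Submodule S (S ⊗[A] m) := LinearMap.ker ι
  let L (D : S →ₗ[A] S) : (S ⊗[A] m) →ₗ[A] (S ⊗[A] m) := D.rTensor m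
  let D (g : G) : S →ₗ[A] S := DistribSMul.toLinearMap A S g
  have hD : ∀ g f, D g f = g • f := fun _ _ => rfl
  have hι : ∀ k : (S ⊗[A] m), ι k = m.subtype.lTensor S k := fun k => rfl
  have hLK : ∀ E : S →ₗ[A] S, ∀ k ∈ K, L E k ∈ K := by
    intro E k hk
    rw [LinearMap.mem_ker, hι] at hk ⊢
    have : m.subtype.lTensor S (L E k) = E.rTensor A (m.subtype.lTensor S k) := by
      rw [← LinearMap.comp_apply, ← LinearMap.comp_apply, LinearMap.rTensor_comp_lTensor,
        LinearMap.lTensor_comp_rTensor]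
    rw [this, hk, map_zero]
  have hsmul : ∀ g : G, ∀ (f : S) (k : (S ⊗[A] m)), L (D g) (f • k) = (g • f) • L (D g) k := by
    intro g f k
    induction k using TensorProduct.induction_on with
    | zero => simp
    | add x y hx hy => simp only [smul_add, map_add, hx, hy]
    | tmul x y => simp [L, hD, TensorProduct.smul_tmul']
  have hmul : ∀ g g' : G, ∀ k : (S ⊗[A] m), L (D (g * g')) k = L (D g) (L (D g') k) := by
    intro g g' k
    have : D (g * g') = D g ∘ₗ D g' := by ext f; simp [hD, mul_smul]
    simp only [L, this, LinearMap.rTensor_comp, LinearMap.comp_apply]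
  have hone : ∀ k : (S ⊗[A] m), L (D 1) k = k := by
    intro k
    have : D 1 = LinearMap.id := by ext f; simp [hD]
    simp [L, this]
  have hstab : ∀ g : G, ∀ k ∈ 𝔫 • K, L (D g) k ∈ 𝔫 • K := by
    intro g k hk
    induction hk using Submodule.smul_induction_on' with
    | smul r hr n hn => rw [hsmul]; exact Submodule.smul_mem_smul (h𝔫 g r hr) (hLK _ _ hn)
    | add x hx y hy hx' hy' => rw [map_add]; exact add_mem hx' hy'
  -- modulo `𝔫 • K`, the group acts trivially on `K`
  have htriv : ∀ g : G, ∀ k ∈ K, L (D g) k - k ∈ 𝔫 • K := by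
    intro g
    have hg : g ∈ Subgroup.closure T := hT ▸ Subgroup.mem_top g
    induction hg using Subgroup.closure_induction with
    | mem s hs =>
      intro k hk
      obtain ⟨α, hα, Δ, hs'⟩ := hΔ s hs
      have h2 : ∀ k : (S ⊗[A] m), L (D s) k = k - α • L Δ k := by
        intro k
        induction k using TensorProduct.induction_on with
        | zero => simp
        | add x y hx hy => simp only [map_add, hx, hy, smul_add]; abel
        | tmul x y => simp [L, hD, hs', TensorProduct.smul_tmul', TensorProduct.sub_tmul]
      rw [h2, sub_sub_cancel_left]
      exact neg_mem (Submodule.smul_mem_smul hα (hLK _ _ hk))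
    | one => intro k hk; simp [hone]
    | mul g g' _ _ hg hg' =>
      intro k hk
      rw [hmul, ← sub_add_sub_cancel _ (L (D g) k), ← map_sub]
      exact add_mem (hstab g _ (hg' k hk)) (hg k hk)
    | inv g _ hg =>
      intro k hk
      have := hstab g⁻¹ _ (neg_mem (hg k hk))
      rwa [neg_sub, map_sub, ← hmul, inv_mul_cancel, hone] at this
  have hinj : Function.Injective (algebraMap A S) := FaithfulSMul.algebraMap_injective A S
  -- the trace vanishes on `K`
  have htr : ∀ k ∈ K, ∑ g : G, L (D g) k = 0 := by
    intro k hk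
    have hex : ∀ f : S, ∃ a : A, algebraMap A S a = ∑ g : G, g • f := fun f =>
      Algebra.IsInvariant.isInvariant (G := G) _ fun g => by
        rw [Finset.smul_sum]
        simp only [← mul_smul]
        exact Fintype.sum_equiv (Equiv.mulLeft g) _ _ fun _ => rfl
    choose τ₀ hτ₀ using hex
    let τ : S →ₗ[A] A :=
      { toFun := τ₀
        map_add' := fun x y => hinj <| by
          simp [hτ₀, Finset.sum_add_distrib]
        map_smul' := fun a x => hinj <| by
          simp [hτ₀, ← Finset.mul_sum, Algebra.smul_def a] }
    have hτ : ∑ g : G, D g = Algebra.linearMap A S ∘ₗ τ := by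
      ext f; simp [τ, hτ₀, hD]
    have h3 : ∑ g : G, L (D g) k = (∑ g : G, D g).rTensor m k := by
      change _ = LinearMap.rTensorHom m (∑ g : G, D g) k
      rw [map_sum, LinearMap.sum_apply]; rfl
    rw [h3, hτ, LinearMap.rTensor_comp, LinearMap.comp_apply]
    have h4 : τ.rTensor m k = 0 := by
      apply Module.Flat.lTensor_preserves_injective_linearMap (M := A) m.subtype
        Subtype.val_injective
      rw [map_zero, ← LinearMap.comp_apply, LinearMap.lTensor_comp_rTensor,
        ← LinearMap.rTensor_comp_lTensor, LinearMap.comp_apply, ← hι, LinearMap.mem_ker.1 hk,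
        map_zero]
    rw [h4, map_zero]
  have hK : K ≤ 𝔫 • K := by
    intro k hk
    have h5 : (Nat.card G : S) • k ∈ 𝔫 • K := by
      have h6 : ∑ g : G, (L (D g) k - k) ∈ 𝔫 • K := sum_mem fun g _ => htriv g k hk
      rw [Finset.sum_sub_distrib, htr k hk, zero_sub, Finset.sum_const, Finset.card_univ,
        ← Nat.card_eq_fintype_card] at h6
      rw [Nat.cast_smul_eq_nsmul]
      exact neg_mem_iff.1 h6
    obtain ⟨u, hu⟩ := hG
    have := Submodule.smul_mem _ (↑u⁻¹ : S) h5
    rwa [← hu, smul_smul, Units.inv_mul, one_smul] at this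
  have hPfin : IsNoetherian S (S ⊗[A] m) := isNoetherian_of_isNoetherianRing_of_finite S (S ⊗[A] m)
  obtain ⟨r, hr, hrK⟩ := Submodule.exists_sub_one_mem_and_smul_eq_zero_of_fg_of_le_smul 𝔫 K
    (IsNoetherian.noetherian K) hK
  obtain ⟨a, ha⟩ := Algebra.IsInvariant.isInvariant (A := A) (G := G) (∏ g : G, g • r) fun g => by
    rw [Finset.smul_prod']
    simp only [← mul_smul]
    exact Fintype.prod_equiv (Equiv.mulLeft g) _ _ fun _ => rfl
  refine ⟨a, ?_, fun k hk => ?_⟩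
  · intro hmem
    rw [Ideal.mem_comap, ha] at hmem
    have hmk : ∀ g : G, Ideal.Quotient.mk 𝔫 (g • r) = 1 := by
      intro g
      have := h𝔫 g _ hr
      rw [smul_sub, smul_one] at this
      rw [← map_one (Ideal.Quotient.mk 𝔫)]
      exact Ideal.Quotient.eq.2 this
    rw [← Ideal.Quotient.eq_zero_iff_mem, map_prod] at hmem
    simp only [hmk, Finset.prod_const_one] at hmem
    rw [← map_one (Ideal.Quotient.mk 𝔫), Ideal.Quotient.eq_zero_iff_mem] at hmem
    exact h1 ((Ideal.eq_top_iff_one _).2 hmem)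
  · have h7 : TensorProduct.comm A m S k ∈ K := by
      rw [LinearMap.mem_ker, hι]
      apply (TensorProduct.comm A S A).injective
      rw [← LinearMap.rTensor_comm] 
      simpa using hk
    apply (TensorProduct.comm A m S).injective
    rw [map_smul, map_zero, ← algebraMap_smul S, ha,
      ← Finset.mul_prod_erase _ _ (Finset.mem_univ (1 : G)), one_smul, mul_comm, mul_smul,
      hrK _ h7, smul_zero]

/-- If `e` generates `S` over `A` away from `p` and `G` acts faithfully modulo `q`, the rows of the
matrix `w • e j` can be separated up to factors outside `p` and `q`. -/
theorem exists_sum_mul_smul_eq_ite {A S G ι : Type*} [CommRing A] [CommRing S]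
    [IsDomain S] [Algebra A S] [Group G] [Fintype G] [MulSemiringAction G S]
    [SMulCommClass G A S] [Fintype ι] [DecidableEq G] (e : ι → S) (p : Ideal A) [p.IsPrime]
    (he : ∀ y, ∃ t ∉ p, t • y ∈ Submodule.span A (Set.range e)) (q : Ideal S) [q.IsPrime]
    (w₀ : G) (hq : ∀ w ≠ w₀, ∃ f : S, w • f - w₀ • f ∉ q) :
    ∃ c : ι → S, ∃ t ∉ p, ∃ u ∉ q, ∀ w : G,
      ∑ j, c j * (w • e j) = if w = w₀ then algebraMap A S t * u else 0 := by
  let ρ : S →+* (G → S) := RingHom.pi fun w => MulSemiringAction.toRingHom G S w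
  have hρ : ∀ y w, ρ y w = w • y := fun _ _ => rfl
  choose! f hf using hq
  let E : G → S := ∏ w ∈ Finset.univ.erase w₀, (algebraMap S (G → S) (w • f w) - ρ (f w))
  have hE : E ∈ Algebra.adjoin S (Set.range ρ) :=
    prod_mem fun w _ => sub_mem (Subalgebra.algebraMap_mem _ _)
      (Algebra.subset_adjoin ⟨_, rfl⟩)
  have hE' : E ∈ Submodule.span S (Set.range ρ) := by
    rw [← Subalgebra.mem_toSubmodule, Algebra.adjoin_eq_span] at hE
    have : Set.range ρ = (MonoidHom.mrange (ρ : S →* (G → S)) : Set (G → S)) := rfl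
    rwa [this, Submonoid.closure_eq, ← this] at hE
  have key : ∀ x ∈ Submodule.span S (Set.range ρ), ∃ t ∉ p,
      algebraMap A S t • x ∈ Submodule.span S (Set.range (ρ ∘ e)) := by
    intro x hx
    induction hx using Submodule.span_induction with
    | mem x hx =>
      obtain ⟨y, rfl⟩ := hx
      obtain ⟨t, ht, hy⟩ := he y
      refine ⟨t, ht, ?_⟩
      have h1 : algebraMap A S t • ρ y = ρ (t • y) := by
        ext w; simp [hρ, Algebra.smul_def]
      rw [h1]
      obtain ⟨c, hc⟩ := (Submodule.mem_span_range_iff_exists_fun A).1 hy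
      rw [← hc, map_sum]
      refine sum_mem fun i _ => ?_
      have h2 : ρ (c i • e i) = algebraMap A S (c i) • ρ (e i) := by
        ext w; simp [hρ, Algebra.smul_def]
      rw [h2]
      exact Submodule.smul_mem _ _ (Submodule.subset_span ⟨i, rfl⟩)
    | zero => exact ⟨1, fun h => (Ideal.ne_top_iff_one p).1 ‹p.IsPrime›.ne_top h, by simp⟩
    | add x y _ _ hx hy =>
      obtain ⟨t, ht, hx⟩ := hx
      obtain ⟨t', ht', hy⟩ := hy
      refine ⟨t * t', ‹p.IsPrime›.mul_notMem ht ht', ?_⟩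
      rw [map_mul, smul_add]
      refine add_mem ?_ ?_
      · rw [mul_comm, mul_smul]; exact Submodule.smul_mem _ _ hx
      · rw [mul_smul]; exact Submodule.smul_mem _ _ hy
    | smul a x _ hx =>
      obtain ⟨t, ht, hx⟩ := hx
      exact ⟨t, ht, by rw [smul_comm]; exact Submodule.smul_mem _ _ hx⟩
  obtain ⟨t, ht, h⟩ := key E hE'
  obtain ⟨c, hc⟩ := (Submodule.mem_span_range_iff_exists_fun S).1 h
  refine ⟨c, t, ht, E w₀, ?_, fun w => ?_⟩
  · simp only [E, Finset.prod_apply]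
    refine fun hmem => ?_
    obtain ⟨w, hw, hmem⟩ := Ideal.IsPrime.prod_mem_iff.1 hmem
    exact hf w (Finset.ne_of_mem_erase hw) hmem
  · have := congrFun hc w
    simp only [Finset.sum_apply, Pi.smul_apply, Function.comp_apply, hρ, smul_eq_mul] at this
    rw [this]
    split_ifs with hw
    · rw [hw]
    · have : E w = 0 := by
        simp only [E, Finset.prod_apply]
        exact Finset.prod_eq_zero (Finset.mem_erase.2 ⟨hw, Finset.mem_univ w⟩)
          (sub_self (w • f w))
      rw [this, mul_zero]

theorem eq_zero_of_sum_mul_smul_eq_zero {A S G ι : Type*} [CommRing A] [CommRing S]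
    [IsDomain S] [Algebra A S] [Group G] [Fintype G] [MulSemiringAction G S] [Fintype ι]
    [Algebra.IsInvariant A S G] [CharZero S] (e : ι → S)
    (he : LinearIndependent A e) (c : ι → S) (hc : ∀ w : G, ∑ j, c j * (w • e j) = 0) :
    c = 0 := by
  classical
  by_contra hne
  obtain ⟨i, hi⟩ := Function.ne_iff.1 hne
  have htr : ∀ f : S, ∃ a : A, algebraMap A S a = ∑ g : G, g • f := fun f =>
    Algebra.IsInvariant.isInvariant (G := G) _ fun g => by
      rw [Finset.smul_sum]
      simp only [← mul_smul]
      exact Fintype.sum_equiv (Equiv.mulLeft g) _ _ fun _ => rfl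
  choose τ hτ using htr
  let t : S := ∏ g ∈ Finset.univ.erase (1 : G), g • c i
  have h1 : ∀ g : G, ∑ j, (g • (t * c j)) * e j = 0 := by
    intro g
    have := congrArg (fun x => g • (t * x)) (hc g⁻¹)
    simp only [mul_zero, smul_zero, Finset.mul_sum, Finset.smul_sum] at this
    rw [← this]
    refine Finset.sum_congr rfl fun j _ => ?_
    rw [← mul_assoc, smul_mul' g (t * c j), smul_inv_smul]
  have h2 : ∑ j, τ (t * c j) • e j = 0 := by
    simp only [Algebra.smul_def, hτ, Finset.sum_mul]
    rw [Finset.sum_comm]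
    exact Finset.sum_eq_zero fun g _ => h1 g
  have h3 := Fintype.linearIndependent_iff.1 he _ h2 i
  have h4 : t * c i = ∏ g : G, g • c i := by
    rw [← Finset.prod_erase_mul _ _ (Finset.mem_univ (1 : G)), one_smul]
  have h5 : ∀ g : G, g • (t * c i) = t * c i := by
    intro g
    rw [h4, Finset.smul_prod']
    simp only [← mul_smul]
    exact Fintype.prod_equiv (Equiv.mulLeft g) _ _ fun _ => rfl
  have h6 := hτ (t * c i)
  simp only [h3, map_zero, h5, Finset.sum_const, Finset.card_univ, nsmul_eq_mul] at h6
  have h7 := mul_eq_zero.1 h6.symm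
  rw [h4, Finset.prod_eq_zero_iff] at h7
  rcases h7 with h7 | ⟨g, -, hg⟩
  · exact Fintype.card_ne_zero (Nat.cast_eq_zero.1 h7)
  · exact hi ((smul_eq_zero_iff_eq g).1 hg)

/-- The Galois-theoretic form of Steinberg's theorem: if the primes `π` in the kernel of `φ` are
unramified over the invariants, then no group element is inert for `φ`. -/
theorem exists_map_smul_ne_of_forall_prime {A S G ι : Type*} [CommRing A] [CommRing S]
    [IsDomain S] [Algebra A S] [Group G] [Fintype G] [MulSemiringAction G S]
    [SMulCommClass G A S] [Fintype ι]
    [Algebra.IsInvariant A S G] [CharZero S]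
    [UniqueFactorizationMonoid S] [FaithfulSMul G S] {B : Type*} [CommRing B] [IsDomain B]
    (φ : S →+* B) (e : ι → S) (hli : LinearIndependent A e) (p : Ideal A) [p.IsPrime]
    (he : ∀ y, ∃ t ∉ p, t • y ∈ Submodule.span A (Set.range e))
    (hinj : Function.Injective (algebraMap A S))
    (hp : ∀ a, φ (algebraMap A S a) = 0 → a ∈ p)
    (hφ : ∀ π : S, Prime π → φ π = 0 → ∀ w w' : G, w ≠ w' → ∃ f : S, ¬ π ∣ w • f - w' • f)
    (g : G) (hg : g ≠ 1) : ∃ f, φ (g • f) ≠ φ f := by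
  classical
  have hfaith : ∀ w w' : G, w ≠ w' → ∃ f : S, w • f - w' • f ∉ (⊥ : Ideal S) := by
    intro w w' h
    by_contra! h'
    exact h (eq_of_smul_eq_smul fun f : S => sub_eq_zero.1 (h' f))
  have hmat : ∀ q : Ideal S, q.IsPrime → (∀ w w' : G, w ≠ w' → ∃ f : S, w • f - w' • f ∉ q) →
      ∃ (C : Matrix G ι S) (t : G → A) (u : G → S), (∀ w, t w ∉ p) ∧ (∀ w, u w ∉ q) ∧
        C * Matrix.of (fun j w => w • e j) =
          Matrix.diagonal fun w => algebraMap A S (t w) * u w := by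
    intro q _ hq
    choose C t ht u hu h using fun w₀ => exists_sum_mul_smul_eq_ite e p he q w₀
      fun w hw => hq w w₀ hw
    refine ⟨Matrix.of C, t, u, ht, hu, ?_⟩
    ext w₀ w
    rw [Matrix.mul_apply, Matrix.diagonal_apply]
    simp only [Matrix.of_apply, h]
    by_cases hw : w = w₀
    · simp [hw]
    · simp [hw, Ne.symm hw]
  obtain ⟨C₀, t₀, u₀, ht₀, hu₀, hC₀⟩ := hmat ⊥ inferInstance hfaith
  have hd₀ : ∀ w, algebraMap A S (t₀ w) * u₀ w ≠ 0 := fun w =>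
    mul_ne_zero (fun h => ht₀ w (by
      rw [(map_eq_zero_iff _ hinj).1 h]; exact zero_mem p)) (hu₀ w)
  have hcard : Fintype.card G = Fintype.card ι := by
    apply le_antisymm
    · refine card_le_of_injective S (Matrix.mulVecLin (Matrix.of (fun j (w : G) => w • e j))) ?_
      rw [injective_iff_map_eq_zero]
      intro x hx
      have := congrArg (C₀.mulVec) hx
      rw [Matrix.mulVecLin_apply, Matrix.mulVec_mulVec, hC₀, Matrix.mulVec_zero] at this
      ext w
      have := congrFun this w
      rw [Matrix.mulVec_diagonal] at this
      exact (mul_eq_zero.1 this).resolve_left (hd₀ w)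
    · refine card_le_of_injective S (Matrix.vecMulLinear (Matrix.of (fun j (w : G) => w • e j))) ?_
      rw [injective_iff_map_eq_zero]
      intro c hc
      exact eq_zero_of_sum_mul_smul_eq_zero e hli c fun w => congrFun hc w
  let σ : ι ≃ G := (Fintype.equivOfCardEq hcard).symm
  let M : Matrix G G S := Matrix.of fun j w => w • e (σ.symm j)
  have hM : ∀ C : Matrix G ι S, C.submatrix id σ.symm * M =
      C * Matrix.of (fun j w => w • e j) := by
    intro C
    ext i w
    simp only [Matrix.mul_apply, M, Matrix.of_apply, Matrix.submatrix_apply, id]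
    exact Fintype.sum_equiv σ.symm _ _ fun _ => rfl
  have hD : M.det ≠ 0 := by
    intro h0
    have := congrArg Matrix.det ((hM C₀).trans hC₀)
    rw [Matrix.det_mul, h0, mul_zero, Matrix.det_diagonal] at this
    exact Finset.prod_ne_zero_iff.2 (fun w _ => hd₀ w) this.symm
  by_contra! hcon
  have hφD : φ M.det = 0 := by
    rw [RingHom.map_det]
    refine Matrix.det_zero_of_column_eq hg fun j => ?_
    simp [M, hcon]
  have hprime : ∀ x : S, x ≠ 0 → φ x = 0 → ∃ π, Prime π ∧ φ π = 0 ∧ π ∣ x := by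
    intro x
    induction x using UniqueFactorizationMonoid.induction_on_prime with
    | h₁ => exact fun h => absurd rfl h
    | h₂ x hx => exact fun _ h => absurd (h ▸ hx.map φ) not_isUnit_zero
    | h₃ x π hx hπ ih =>
      intro _ h
      rcases mul_eq_zero.1 ((map_mul φ _ _).symm.trans h) with h | h
      · exact ⟨π, hπ, h, dvd_mul_right _ _⟩
      · obtain ⟨π', h1, h2, h3⟩ := ih hx h
        exact ⟨π', h1, h2, h3.mul_left _⟩
  obtain ⟨π, hπ, hφπ, hdvd⟩ := hprime _ hD hφD
  obtain ⟨C, t, u, ht, hu, hC⟩ := hmat (Ideal.span {π})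
    ((Ideal.span_singleton_prime hπ.ne_zero).2 hπ) (by
      simpa only [Ideal.mem_span_singleton] using hφ π hπ hφπ)
  have hdet := congrArg Matrix.det ((hM C).trans hC)
  rw [Matrix.det_mul, Matrix.det_diagonal] at hdet
  have h8 : π ∣ ∏ w, algebraMap A S (t w) * u w := hdet ▸ hdvd.mul_left _
  obtain ⟨w, -, hw⟩ := hπ.exists_mem_finset_dvd h8
  rcases hπ.dvd_or_dvd hw with h | h
  · refine ht w (hp _ ?_)
    obtain ⟨r, hr⟩ := h
    rw [hr, map_mul, hφπ, zero_mul]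
  · exact hu w (Ideal.mem_span_singleton.2 h)

section PolynomialFunctions

open MvPolynomial

variable {U : Type*} [AddCommGroup U] [Module ℂ U] {n : ℕ} (b : Basis (Fin n) ℂ U)

/-- Evaluation of a polynomial in the coordinates of `b` at a vector. -/
def evalAt (v : U) : MvPolynomial (Fin n) ℂ →ₐ[ℂ] ℂ := aeval fun i => b.repr v i

/-- A linear functional as a linear polynomial in the coordinates of `b`. -/
def linearForm (ψ : Dual ℂ U) : MvPolynomial (Fin n) ℂ := ∑ j, C (ψ (b j)) * X j

/-- The action of an automorphism on polynomial functions, `(g f)(v) = f (g⁻¹ v)`. -/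
def polyAct (g : U ≃ₗ[ℂ] U) : MvPolynomial (Fin n) ℂ →ₐ[ℂ] MvPolynomial (Fin n) ℂ :=
  aeval fun i => linearForm b (b.coord i ∘ₗ (g⁻¹ : U ≃ₗ[ℂ] U).toLinearMap)

theorem evalAt_ext {f f' : MvPolynomial (Fin n) ℂ} (h : ∀ v, evalAt b v f = evalAt b v f') :
    f = f' := by
  refine MvPolynomial.funext fun x => ?_
  have := h (b.equivFun.symm x)
  have hx : ∀ f, evalAt b (b.equivFun.symm x) f = eval x f := fun f => by
    rw [evalAt, ← MvPolynomial.aeval_eq_eval]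
    congr 2
    exact funext fun i => congrFun (b.equivFun.apply_symm_apply x) i
  rwa [hx, hx] at this

theorem evalAt_linearForm (ψ : Dual ℂ U) (v : U) : evalAt b v (linearForm b ψ) = ψ v := by
  conv_rhs => rw [← b.sum_repr v, map_sum]
  simp [evalAt, linearForm, mul_comm]

theorem evalAt_polyAct (g : U ≃ₗ[ℂ] U) (f : MvPolynomial (Fin n) ℂ) (v : U) :
    evalAt b v (polyAct b g f) = evalAt b (g⁻¹ v) f := by
  suffices (evalAt b v).comp (polyAct b g) = evalAt b (g⁻¹ v) from DFunLike.congr_fun this f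
  ext i
  rw [AlgHom.comp_apply, polyAct, aeval_X, evalAt_linearForm]
  simp [evalAt]

theorem evalAt_zero_linearForm (ψ : Dual ℂ U) : evalAt b 0 (linearForm b ψ) = 0 := by
  rw [evalAt_linearForm, map_zero]

/-- The action of a group of automorphisms on polynomial functions. -/
abbrev polyMulSemiringAction (W : Subgroup (U ≃ₗ[ℂ] U)) :
    MulSemiringAction W (MvPolynomial (Fin n) ℂ) where
  smul g f := polyAct b g f
  one_smul f := evalAt_ext b fun v => by
    change evalAt b v (polyAct b _ f) = _
    rw [evalAt_polyAct]; simp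
  mul_smul g h f := evalAt_ext b fun v => by
    change evalAt b v (polyAct b _ f) = evalAt b v (polyAct b _ (polyAct b _ f))
    rw [evalAt_polyAct, evalAt_polyAct, evalAt_polyAct]; simp
  smul_zero g := map_zero (polyAct b g)
  smul_add g := map_add (polyAct b g)
  smul_one g := map_one (polyAct b g)
  smul_mul g := map_mul (polyAct b g)

theorem linearForm_eq_zero_iff (ψ : Dual ℂ U) : linearForm b ψ = 0 ↔ ψ = 0 := by
  constructor
  · intro h
    ext v
    rw [← evalAt_linearForm b, h]; simp
  · rintro rfl
    exact evalAt_ext b fun v => by rw [evalAt_linearForm]; simp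

theorem totalDegree_linearForm_le (ψ : Dual ℂ U) : (linearForm b ψ).totalDegree ≤ 1 := by
  refine totalDegree_finsetSum_le fun i _ => (totalDegree_mul _ _).trans ?_
  simp

theorem exists_eq_mul_C_of_dvd_linearForm {π : MvPolynomial (Fin n) ℂ} (hπ : ¬ IsUnit π)
    {ψ : Dual ℂ U} (h : π ∣ linearForm b ψ) : ∃ c, linearForm b ψ = π * C c := by
  obtain ⟨r, hr⟩ := h
  by_cases h0 : linearForm b ψ = 0
  · exact ⟨0, by simp [h0]⟩
  have h1 : π ≠ 0 := fun h => h0 (by rw [hr, h, zero_mul])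
  have h2 : r ≠ 0 := fun h => h0 (by rw [hr, h, mul_zero])
  have h3 := totalDegree_mul_of_isDomain h1 h2
  rw [← hr] at h3
  have h4 := totalDegree_linearForm_le b ψ
  have h5 : π.totalDegree ≠ 0 := by
    intro h
    rw [totalDegree_eq_zero_iff_eq_C.1 h] at h1 hπ
    exact hπ ((IsUnit.mk0 _ fun h => h1 (by rw [h, C_0])).map C)
  exact ⟨_, by rw [hr, ← totalDegree_eq_zero_iff_eq_C.1 (by lia : r.totalDegree = 0)]⟩

theorem linearForm_dvd_sub_polyAct (s : U ≃ₗ[ℂ] U) (α : Dual ℂ U) (a : U)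
    (h : ∀ x, s⁻¹ x = x - α x • a) (f : MvPolynomial (Fin n) ℂ) :
    linearForm b α ∣ f - polyAct b s f := by
  rw [← Ideal.mem_span_singleton, ← Ideal.Quotient.eq]
  let mk := Ideal.Quotient.mkₐ ℂ (Ideal.span {linearForm b α})
  suffices mk = mk.comp (polyAct b s) from DFunLike.congr_fun this f
  ext i
  rw [AlgHom.comp_apply, Ideal.Quotient.mkₐ_eq_mk, Ideal.Quotient.eq, Ideal.mem_span_singleton]
  refine ⟨C (b.repr a i), evalAt_ext b fun v => ?_⟩
  rw [map_sub, evalAt_polyAct, map_mul, evalAt_linearForm, h]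
  simp [evalAt]

theorem IsReflection.exists_inv_apply_eq [FiniteDimensional ℂ U] {s : U ≃ₗ[ℂ] U}
    (hs : IsReflection s) :
    ∃ (α : Dual ℂ U) (a : U), α ≠ 0 ∧ ∀ x, s⁻¹ x = x - α x • a := by
  let d : U →ₗ[ℂ] U := LinearMap.id - (s⁻¹ : U ≃ₗ[ℂ] U).toLinearMap
  have hd : ∀ x, d x = x - s⁻¹ x := fun x => rfl
  have hker : LinearMap.ker d = LinearMap.ker ((s : U →ₗ[ℂ] U) - LinearMap.id) := by
    ext x
    rw [LinearMap.mem_ker, LinearMap.mem_ker, hd, sub_eq_zero]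
    change x = s.symm x ↔ s x - x = 0
    rw [sub_eq_zero, LinearEquiv.eq_symm_apply]
  have hrank : finrank ℂ (LinearMap.range d) = 1 := by
    have h1 := LinearMap.finrank_range_add_finrank_ker d
    rw [hker] at h1
    have h2 : _ + 1 = _ := hs
    lia
  obtain ⟨⟨a, ha⟩, ha0, h⟩ := finrank_eq_one_iff'.1 hrank
  have ha0' : a ≠ 0 := fun h => ha0 (Subtype.ext h)
  obtain ⟨θ, hθ⟩ := Projective.exists_dual_eq_one ℂ ha0'
  have key : ∀ x, d x = θ (d x) • a := by
    intro x
    obtain ⟨c, hc⟩ := h ⟨d x, LinearMap.mem_range_self d x⟩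
    have hc' : c • a = d x := congrArg Subtype.val hc
    rw [← hc', map_smul, hθ, smul_eq_mul, mul_one]
  refine ⟨θ ∘ₗ d, a, fun h0 => ?_, fun x => ?_⟩
  · obtain ⟨x, hx⟩ := ha
    have := DFunLike.congr_fun h0 x
    rw [LinearMap.comp_apply, hx, hθ] at this
    exact one_ne_zero this
  · rw [LinearMap.comp_apply, ← key, hd, sub_sub_cancel]

/-- A difference of automorphisms all of whose matrix coefficients share a nontrivial factor
comes from a reflection. -/
theorem isReflection_of_forall_dvd [FiniteDimensional ℂ U] {w w' : U ≃ₗ[ℂ] U} (hw : w ≠ w')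
    {π : MvPolynomial (Fin n) ℂ} (hπ : ¬ IsUnit π)
    (h : ∀ f, π ∣ polyAct b w f - polyAct b w' f) {v : U} (hv : evalAt b v π = 0) :
    IsReflection (w' * w⁻¹) ∧ (w' * w⁻¹) v = v := by
  let d : U →ₗ[ℂ] U := (w⁻¹ : U ≃ₗ[ℂ] U).toLinearMap - (w'⁻¹ : U ≃ₗ[ℂ] U).toLinearMap
  have hd : ∀ x, d x = w⁻¹ x - w'⁻¹ x := fun x => rfl
  have hfix : ∀ x, d x = 0 ↔ (w' * w⁻¹) x = x := by
    intro x
    rw [hd, sub_eq_zero, LinearEquiv.mul_apply]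
    exact (LinearEquiv.eq_symm_apply w')
  have hC : ∀ ψ : Dual ℂ U, ∃ c, linearForm b (ψ ∘ₗ d) = π * C c := by
    intro ψ
    refine exists_eq_mul_C_of_dvd_linearForm b hπ ?_
    convert h (linearForm b ψ) using 1
    refine evalAt_ext b fun x => ?_
    simp only [map_sub, evalAt_polyAct, evalAt_linearForm, LinearMap.comp_apply, hd]
  choose c hc using hC
  have hval : ∀ ψ x, ψ (d x) = evalAt b x π * c ψ := by
    intro ψ x
    have := congrArg (evalAt b x) (hc ψ)
    rw [evalAt_linearForm, map_mul] at this
    simpa [evalAt] using this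
  have hker : ∀ x, evalAt b x π = 0 → d x = 0 := by
    intro x hx
    rw [← Module.forall_dual_apply_eq_zero_iff ℂ]
    intro ψ
    rw [hval, hx, zero_mul]
  refine ⟨?_, (hfix v).1 (hker v hv)⟩
  obtain ⟨x, hx⟩ : ∃ x, d x ≠ 0 := by
    by_contra! hcon
    refine hw (inv_injective (LinearEquiv.ext fun x => ?_))
    exact sub_eq_zero.1 (hcon x)
  obtain ⟨ψ, hψ⟩ := Projective.exists_dual_eq_one ℂ hx
  have hcψ : c ψ ≠ 0 := by
    intro h0
    rw [hval, h0, mul_zero] at hψ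
    exact zero_ne_one hψ
  have hne : ψ ∘ₗ d ≠ 0 := by
    intro h0
    have := DFunLike.congr_fun h0 x
    rw [LinearMap.comp_apply, hψ] at this
    exact one_ne_zero this
  have hkk : LinearMap.ker ((w' * w⁻¹ : U ≃ₗ[ℂ] U).toLinearMap - LinearMap.id) =
      LinearMap.ker (ψ ∘ₗ d) := by
    ext y
    rw [LinearMap.mem_ker, LinearMap.mem_ker, LinearMap.comp_apply]
    change (w' * w⁻¹) y - y = 0 ↔ _
    rw [sub_eq_zero, ← hfix]
    refine ⟨fun h => by rw [h, map_zero], fun h => hker y ?_⟩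
    rw [hval] at h
    exact (mul_eq_zero.1 h).resolve_right hcψ
  rw [IsReflection, hkk]
  exact Module.Dual.finrank_ker_add_one_of_ne_zero hne

end PolynomialFunctions

section Steinberg

open MvPolynomial

variable {U : Type*} [AddCommGroup U] [Module ℂ U] [FiniteDimensional ℂ U]

/-- A vector fixed by no reflection of a complex reflection group has trivial stabilizer. -/
theorem eq_one_of_forall_isReflection_ne (W : Subgroup (U ≃ₗ[ℂ] U)) [Finite W]
    (hW : Subgroup.closure {g : U ≃ₗ[ℂ] U | g ∈ W ∧ IsReflection g} = W) (v : U)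
    (hv : ∀ s ∈ W, IsReflection s → s v ≠ v) {w : U ≃ₗ[ℂ] U} (hw : w ∈ W) (hwv : w v = v) :
    w = 1 := by
  classical
  have := Fintype.ofFinite W
  let b := finBasis ℂ U
  let S := MvPolynomial (Fin (finrank ℂ U)) ℂ
  let _ : MulSemiringAction W S := polyMulSemiringAction b W
  have hsmul : ∀ (g : W) (f : S), g • f = polyAct b g f := fun _ _ => rfl
  have hcomm : SMulCommClass W ℂ S := ⟨fun g a f => map_smul (polyAct b g) a f⟩
  let A := FixedPoints.subalgebra ℂ S W
  have hinj : Function.Injective (algebraMap A S) := Subtype.val_injective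
  have hinv : Algebra.IsInvariant A S W := ⟨fun f hf => ⟨⟨f, hf⟩, rfl⟩⟩
  have hft : Algebra.FiniteType A S := Algebra.FiniteType.of_restrictScalars_finiteType ℂ A S
  have hint : Algebra.IsIntegral A S := Algebra.IsInvariant.isIntegral A S W
  have hfin : Module.Finite A S := Algebra.IsIntegral.finite
  have hftA : Algebra.FiniteType ℂ A := ⟨fg_of_fg_of_fg ℂ A S Algebra.FiniteType.out
    Module.Finite.fg_top hinj⟩
  have hnoeth : IsNoetherianRing A := Algebra.FiniteType.isNoetherianRing ℂ A
  have hfaith : FaithfulSMul W S := ⟨fun {g g'} h => by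
    refine Subtype.ext (inv_injective (LinearEquiv.ext fun x => b.ext_elem fun i => ?_))
    have := congrArg (evalAt b x) (h (X i))
    rw [hsmul, hsmul, evalAt_polyAct, evalAt_polyAct] at this
    simpa [evalAt] using this⟩
  let 𝔫 : Ideal S := RingHom.ker (evalAt b 0)
  have h𝔫 : 𝔫.IsPrime := RingHom.ker_isPrime _
  have hT : Subgroup.closure {g : W | IsReflection (g : U ≃ₗ[ℂ] U)} = ⊤ := by
    apply Subgroup.map_injective W.subtype_injective
    rw [MonoidHom.map_closure, ← MonoidHom.range_eq_map, Subgroup.range_subtype]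
    conv_rhs => rw [← hW]
    congr 1
    ext g
    constructor
    · rintro ⟨g, hg, rfl⟩; exact ⟨g.2, hg⟩
    · rintro ⟨h, hg⟩; exact ⟨⟨g, h⟩, hg, rfl⟩
  have hΔ : ∀ g ∈ {g : W | IsReflection (g : U ≃ₗ[ℂ] U)}, ∃ α ∈ 𝔫, ∃ Δ : S →ₗ[A] S,
      ∀ f, g • f = f - α * Δ f := by
    intro g hg
    obtain ⟨α, a, hα, h⟩ := IsReflection.exists_inv_apply_eq hg
    have hα0 : linearForm b α ≠ 0 := fun h0 => hα ((linearForm_eq_zero_iff b α).1 h0)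
    choose Δ hΔ using linearForm_dvd_sub_polyAct b (g : U ≃ₗ[ℂ] U) α a h
    refine ⟨linearForm b α, evalAt_zero_linearForm b α,
      { toFun := Δ, map_add' := fun x y => ?_, map_smul' := fun c x => ?_ }, fun f => ?_⟩
    · apply mul_left_cancel₀ hα0
      rw [mul_add, ← hΔ, ← hΔ, ← hΔ, map_add]; ring
    · apply mul_left_cancel₀ hα0
      rw [RingHom.id_apply, mul_smul_comm, ← hΔ, ← hΔ, smul_sub]
      congr 1
      exact smul_comm g c x
    · rw [hsmul]
      change _ = f - linearForm b α * Δ f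
      rw [← hΔ, sub_sub_cancel]
  obtain ⟨a, ha, hK⟩ := exists_smul_ker_rTensor_eq_zero (A := A) (S := S) (G := W)
    (by
      rw [← map_natCast (C : ℂ →+* S)]
      exact (IsUnit.mk0 _ (Nat.cast_ne_zero.2 Nat.card_pos.ne')).map C)
    𝔫 h𝔫.ne_top
    (fun g f hf => by
      rw [RingHom.mem_ker] at hf ⊢
      rw [hsmul, evalAt_polyAct, map_zero, hf]) _ hT hΔ
  obtain ⟨m, e, hli, he⟩ := exists_linearIndependent_of_rTensor_ker (𝔫.under A) a ha hK
  let φ : S →ₐ[ℂ] Polynomial ℂ := aeval fun i => Polynomial.C (b.repr v i) * Polynomial.X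
  have hφ : ∀ t f, (φ f).eval t = evalAt b (t • v) f := by
    intro t f
    suffices (Polynomial.aeval t).comp φ = evalAt b (t • v) by
      rw [← this, AlgHom.comp_apply, Polynomial.coe_aeval_eq_eval]
    ext i
    rw [AlgHom.comp_apply, aeval_X, evalAt, aeval_X, map_mul, Polynomial.aeval_X,
      Polynomial.aeval_C, map_smul, mul_comm]
    rfl
  by_contra hne
  obtain ⟨f, hf⟩ := exists_map_smul_ne_of_forall_prime (G := W) φ.toRingHom e hli (𝔫.under A) he
    hinj
    (fun a h => by
      have h0 : φ (algebraMap A S a) = 0 := h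
      have := hφ 0 (algebraMap A S a)
      rw [h0, zero_smul, Polynomial.eval_zero] at this
      exact this.symm)
    (fun π hπ hπ0 g g' hgg => by
      by_contra! hcon
      have h0 : evalAt b v π = 0 := by
        have h1 : φ π = 0 := hπ0
        have := hφ 1 π
        rw [h1, one_smul, Polynomial.eval_zero] at this
        exact this.symm
      obtain ⟨h1, h2⟩ := isReflection_of_forall_dvd b (fun h => hgg (Subtype.ext h)) hπ.not_isUnit
        hcon h0
      exact hv _ (mul_mem g'.2 (inv_mem g.2)) h1 h2)
    ⟨w, hw⟩ (fun h => hne (congrArg Subtype.val h))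
  refine hf (Polynomial.funext fun t => ?_)
  change (φ _).eval t = (φ f).eval t
  rw [hφ, hφ, hsmul, evalAt_polyAct, map_smul]
  congr 1
  exact congrArg (fun x => evalAt b (t • x)) ((LinearEquiv.symm_apply_eq w).2 hwv.symm)

end Steinberg

/-- (Steinberg–Serre) A vector has nontrivial stabilizer in the complex reflection group `W`
if and only if it lies in some reflecting hyperplane; equivalently,
`V_reg = V ∖ ⋃_{s ∈ Ref(W)} V^s`. -/
theorem stmt5 (W : Subgroup (V ≃ₗ[ℂ] V)) [Finite W]
    (hW : Subgroup.closure {g : V ≃ₗ[ℂ] V | g ∈ W ∧ IsReflection g} = W) :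
    (∀ v : V, (∃ w ∈ W, w ≠ 1 ∧ w v = v) ↔ (∃ s ∈ W, IsReflection s ∧ s v = v)) ∧
    VReg W = Set.univ \ ⋃ s ∈ {g : V ≃ₗ[ℂ] V | g ∈ W ∧ IsReflection g}, {v : V | s v = v} ∧
    (∀ v : V, (∀ s ∈ W, IsReflection s → s v ≠ v) → ∀ w ∈ W, w v = v → w = 1) := by
  have key : ∀ v : V, (∀ s ∈ W, IsReflection s → s v ≠ v) → ∀ w ∈ W, w v = v → w = 1 :=
    fun v hv w hw hwv => eq_one_of_forall_isReflection_ne W hW v hv hw hwv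
  have hne : ∀ s : V ≃ₗ[ℂ] V, IsReflection s → s ≠ 1 := by
    rintro s hs rfl
    have h0 : ((1 : V ≃ₗ[ℂ] V) : V →ₗ[ℂ] V) - LinearMap.id = 0 := sub_self _
    rw [IsReflection, h0, LinearMap.ker_zero, finrank_top] at hs
    lia
  refine ⟨fun v => ⟨?_, ?_⟩, ?_, key⟩
  · rintro ⟨w, hw, hw1, hwv⟩
    by_contra! hcon
    exact hw1 (key v hcon w hw hwv)
  · rintro ⟨s, hs, hs', hsv⟩
    exact ⟨s, hs, hne s hs', hsv⟩
  · ext v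
    simp only [VReg, Set.mem_ofPred_eq, Set.mem_sdiff, Set.mem_univ, true_and, Set.mem_iUnion,
      exists_prop, not_exists, not_and]
    exact ⟨fun h s hs hsv => hne s hs.2 (h s hs.1 hsv),
      fun h => key v fun s hs hs' => h s ⟨hs, hs'⟩⟩
end
end

section
/- For every v ∈ V_reg and every function c : Ref(W) → ℂ constant on W-conjugacy classes, the Gaudin operators pairwise commute: D_y^{c,v} · D_{y'}^{c,v} = D_{y'}^{c,v} · D_y^{c,v} in the group algebra ℂW, for all y, y' ∈ V. -/
open Module

noncomputable section

variable {V : Type*} [AddCommGroup V] [Module ℂ V] [FiniteDimensional ℂ V]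

open Classical in
/-- The Gaudin operator `D_y^{c,v} = Σ_{s ∈ Ref(W)} ε(s)·c(s)·(α_s(y)/α_s(v))·s`
in the group algebra `ℂW`. -/
def Gaudin (W : Subgroup (V ≃ₗ[ℂ] V)) [Fintype W] (c : W → ℂ)
    (α : W → Module.Dual ℂ V) (v y : V) : MonoidAlgebra ℂ W :=
  ∑ s : W, if IsReflection (s : V ≃ₗ[ℂ] V) then
    MonoidAlgebra.single s
      (LinearMap.det ((s : V ≃ₗ[ℂ] V) : V →ₗ[ℂ] V) * c s * (α s y / α s v))
  else 0

/-- The two-form `a ∧ b`, as a linear form in its second argument. -/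
def wedge (a b : Dual ℂ V) (y : V) : Dual ℂ V := a y • b - b y • a

omit [FiniteDimensional ℂ V] in
lemma exists_smul_eq_of_ker_le {a b : Dual ℂ V} (h : LinearMap.ker a ≤ LinearMap.ker b) :
    ∃ r : ℂ, b = r • a := by
  have hb := mem_span_of_iInf_ker_le_ker (L := fun _ : Unit => a) (K := b) (by simpa using h)
  rw [Set.range_const, Submodule.mem_span_singleton] at hb
  obtain ⟨r, hr⟩ := hb
  exact ⟨r, hr.symm⟩

omit [FiniteDimensional ℂ V] in
lemma mem_ker_sub_id {g : V ≃ₗ[ℂ] V} {x : V} :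
    x ∈ LinearMap.ker ((g : V →ₗ[ℂ] V) - LinearMap.id) ↔ g x = x := by
  simp [sub_eq_zero]

omit [FiniteDimensional ℂ V] in
lemma IsReflection.ne_one {g : V ≃ₗ[ℂ] V} (hg : IsReflection g) : g ≠ 1 := by
  rintro rfl
  have h : LinearMap.ker (((1 : V ≃ₗ[ℂ] V) : V →ₗ[ℂ] V) - LinearMap.id) = ⊤ :=
    eq_top_iff.2 fun x _ => mem_ker_sub_id.2 rfl
  rw [IsReflection, h, finrank_top] at hg
  omega

omit [FiniteDimensional ℂ V] in
lemma IsReflection.conj {g : V ≃ₗ[ℂ] V} (hg : IsReflection g) (h : V ≃ₗ[ℂ] V) :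
    IsReflection (h * g * h⁻¹) := by
  have hk : LinearMap.ker (((h * g * h⁻¹ : V ≃ₗ[ℂ] V) : V →ₗ[ℂ] V) - LinearMap.id) =
      (LinearMap.ker ((g : V →ₗ[ℂ] V) - LinearMap.id)).map (h : V →ₗ[ℂ] V) := by
    ext x
    rw [mem_ker_sub_id, Submodule.mem_map_equiv, mem_ker_sub_id, LinearEquiv.eq_symm_apply]
    rfl
  rw [IsReflection, hk, LinearEquiv.finrank_map_eq]
  exact hg

omit [FiniteDimensional ℂ V] in
lemma isReflection_conj_iff (g h : V ≃ₗ[ℂ] V) :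
    IsReflection (h * g * h⁻¹) ↔ IsReflection g := by
  refine ⟨fun H => ?_, fun H => H.conj h⟩
  have := H.conj h⁻¹
  rwa [show h⁻¹ * (h * g * h⁻¹) * h⁻¹⁻¹ = g by group] at this

/-- The Hurwitz move `(s, t) ↦ (t, t⁻¹ s t)` on pairs of elements of a group. -/
def hurwitzMove (G : Type*) [Group G] : G × G ≃ G × G where
  toFun p := (p.2, p.2⁻¹ * p.1 * p.2)
  invFun p := (p.1 * p.2 * p.1⁻¹, p.1)
  left_inv p := by ext <;> simp [mul_assoc]
  right_inv p := by ext <;> simp [mul_assoc]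

/-- A function on pairs that is invariant under the Hurwitz move is orthogonal to every
function of the form `(s, t) ↦ f t - f s`. -/
lemma sum_sub_smul_eq_zero_of_hurwitzMove {G M : Type*} [Group G] [Fintype G] [AddCommGroup M]
    [Module ℂ M] (F : G × G → M) (hF : ∀ p, F (hurwitzMove G p) = F p) (f : G → ℂ) :
    ∑ p, (f p.2 - f p.1) • F p = 0 := by
  simp_rw [sub_smul, Finset.sum_sub_distrib]
  rw [sub_eq_zero, ← Equiv.sum_comp (hurwitzMove G) fun p => f p.1 • F p]
  simp_rw [hF]
  rfl

omit [FiniteDimensional ℂ V] in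
/-- If `t` fixes the kernel of `b` pointwise, then replacing `(a, b)` by `(b, a')`, where `a'` has
the same kernel as `a ∘ t`, rescales the two-form `a ∧ b`. -/
lemma exists_wedge_eq_smul {a b a' : Dual ℂ V} {t : V ≃ₗ[ℂ] V}
    (ht : ∀ x, b x = 0 → t x = x) (ha' : ∀ x, a (t x) = 0 → a' x = 0) (h0 : a' ≠ 0) :
    ∃ μ : ℂ, μ ≠ 0 ∧ ∀ y y', wedge b a' y y' = μ * wedge a b y y' := by
  obtain ⟨l, hl⟩ := exists_smul_eq_of_ker_le (a := b) (b := a ∘ₗ (t : V →ₗ[ℂ] V) - a) (by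
    intro x hx
    simp [ht x hx])
  obtain ⟨r, hr⟩ := exists_smul_eq_of_ker_le (a := a ∘ₗ (t : V →ₗ[ℂ] V)) (b := a')
    fun x hx => ha' x hx
  rw [sub_eq_iff_eq_add] at hl
  rw [hl] at hr
  refine ⟨-r, ?_, fun y y' => ?_⟩
  · rw [neg_ne_zero]
    rintro rfl
    exact h0 (by rw [hr, zero_smul])
  · simp only [wedge, hr, LinearMap.sub_apply, LinearMap.smul_apply, LinearMap.add_apply,
      smul_eq_mul]
    ring

omit [FiniteDimensional ℂ V] in
lemma exists_forall_wedge_eq_zero_of_apply_eq_zero {ι : Type*} [Finite ι] (a : ι → Dual ℂ V)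
    (v : V) : ∃ z : V, ∀ i j, wedge (a i) (a j) v z = 0 → wedge (a i) (a j) v = 0 := by
  obtain ⟨z, hz⟩ := Dual.exists_forall_ne_zero_of_forall_exists
    (fun p : {p : ι × ι // wedge (a p.1) (a p.2) v ≠ 0} => wedge (a p.1.1) (a p.1.2) v)
    fun p => by
      by_contra! H
      exact p.2 (LinearMap.ext H)
  refine ⟨z, fun i j h => ?_⟩
  by_contra H
  exact hz ⟨(i, j), H⟩ h

omit [FiniteDimensional ℂ V] in
/-- A two-form `a ∧ b` vanishes if its contraction with a vector on which `a` and `b` are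
nonzero vanishes. -/
lemma wedge_eq_zero {a b : Dual ℂ V} {v : V} (ha : a v ≠ 0) (h : wedge a b v = 0) (y y' : V) :
    wedge a b y y' = 0 := by
  have hb (x : V) : b x = b v / a v * a x := by
    have := LinearMap.congr_fun h x
    simp only [wedge, LinearMap.sub_apply, LinearMap.smul_apply, smul_eq_mul,
      LinearMap.zero_apply] at this
    field_simp
    linear_combination this
  simp only [wedge, LinearMap.sub_apply, LinearMap.smul_apply, smul_eq_mul, hb y, hb y']
  ring

open Classical in
/-- The coefficient `ε(s) c(s)`, extended by zero to the elements that are not reflections. -/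
def reflCoeff (W : Subgroup (V ≃ₗ[ℂ] V)) (c : W → ℂ) (s : W) : ℂ :=
  if IsReflection (s : V ≃ₗ[ℂ] V) then
    LinearMap.det ((s : V ≃ₗ[ℂ] V) : V →ₗ[ℂ] V) * c s else 0

omit [FiniteDimensional ℂ V] in
lemma isReflection_of_reflCoeff_ne_zero {W : Subgroup (V ≃ₗ[ℂ] V)} {c : W → ℂ} {s : W}
    (h : reflCoeff W c s ≠ 0) : IsReflection (s : V ≃ₗ[ℂ] V) := by
  by_contra H
  exact h (if_neg H)

omit [FiniteDimensional ℂ V] in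
lemma reflCoeff_conj {W : Subgroup (V ≃ₗ[ℂ] V)} {c : W → ℂ}
    (hc : ∀ s w : W, IsReflection (s : V ≃ₗ[ℂ] V) → c (w * s * w⁻¹) = c s) (s w : W) :
    reflCoeff W c (w * s * w⁻¹) = reflCoeff W c s := by
  have hd : LinearMap.det (((w * s * w⁻¹ : W) : V ≃ₗ[ℂ] V) : V →ₗ[ℂ] V) =
      LinearMap.det ((s : V ≃ₗ[ℂ] V) : V →ₗ[ℂ] V) :=
    LinearMap.det_conj ((s : V ≃ₗ[ℂ] V) : V →ₗ[ℂ] V) (w : V ≃ₗ[ℂ] V)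
  have hr : IsReflection ((w * s * w⁻¹ : W) : V ≃ₗ[ℂ] V) ↔ IsReflection (s : V ≃ₗ[ℂ] V) :=
    isReflection_conj_iff _ _
  unfold reflCoeff
  by_cases h : IsReflection (s : V ≃ₗ[ℂ] V)
  · rw [if_pos h, if_pos (hr.2 h), hd, hc s w h]
  · rw [if_neg h, if_neg (mt hr.1 h)]

omit [FiniteDimensional ℂ V] in
lemma gaudin_eq_sum (W : Subgroup (V ≃ₗ[ℂ] V)) [Fintype W] (c : W → ℂ) (α : W → Dual ℂ V)
    (v y : V) :
    Gaudin W c α v y = ∑ s : W, MonoidAlgebra.single s (reflCoeff W c s * (α s y / α s v)) := by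
  refine Finset.sum_congr rfl fun s _ => ?_
  unfold reflCoeff
  split_ifs <;> simp

omit [FiniteDimensional ℂ V] in
lemma gaudin_mul_sub_mul (W : Subgroup (V ≃ₗ[ℂ] V)) [Fintype W] (c : W → ℂ) (α : W → Dual ℂ V)
    (v y y' : V) :
    Gaudin W c α v y * Gaudin W c α v y' - Gaudin W c α v y' * Gaudin W c α v y =
      ∑ p : W × W, MonoidAlgebra.single (p.1 * p.2) (reflCoeff W c p.1 * reflCoeff W c p.2 *
        (wedge (α p.1) (α p.2) y y' / (α p.1 v * α p.2 v))) := by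
  simp_rw [gaudin_eq_sum, Finset.sum_mul_sum, MonoidAlgebra.single_mul_single,
    ← Finset.sum_sub_distrib, ← MonoidAlgebra.single_sub]
  rw [Fintype.sum_prod_type]
  refine Finset.sum_congr rfl fun s _ => Finset.sum_congr rfl fun t _ => ?_
  congr 1
  simp only [wedge, LinearMap.sub_apply, LinearMap.smul_apply, smul_eq_mul]
  ring

/-- For `v ∈ V_reg` and a class function `c` on the reflections of `W`, the Gaudin
operators pairwise commute in `ℂW`. -/
theorem stmt7 (W : Subgroup (V ≃ₗ[ℂ] V)) [Fintype W]
    (hW : Subgroup.closure {g : V ≃ₗ[ℂ] V | g ∈ W ∧ IsReflection g} = W)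
    (α : W → Module.Dual ℂ V)
    (hα : ∀ s : W, IsReflection (s : V ≃ₗ[ℂ] V) →
      LinearMap.ker (α s) = LinearMap.ker (((s : V ≃ₗ[ℂ] V) : V →ₗ[ℂ] V) - LinearMap.id))
    (c : W → ℂ)
    (hc : ∀ s w : W, IsReflection (s : V ≃ₗ[ℂ] V) → c (w * s * w⁻¹) = c s)
    (v : V) (hv : v ∈ VReg W) (y y' : V) :
    Gaudin W c α v y * Gaudin W c α v y' = Gaudin W c α v y' * Gaudin W c α v y := by
  have hne (s : W) (hs : IsReflection (s : V ≃ₗ[ℂ] V)) : α s v ≠ 0 := fun h => by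
    rw [← LinearMap.mem_ker, hα s hs, mem_ker_sub_id] at h
    exact hs.ne_one (hv s s.2 h)
  obtain ⟨z, hz⟩ := exists_forall_wedge_eq_zero_of_apply_eq_zero α v
  let F (p : W × W) : MonoidAlgebra ℂ W :=
    MonoidAlgebra.single (p.1 * p.2) (reflCoeff W c p.1 * reflCoeff W c p.2 *
      (wedge (α p.1) (α p.2) y y' / wedge (α p.1) (α p.2) v z))
  have hF (p : W × W) : F (hurwitzMove W p) = F p := by
    obtain ⟨s, t⟩ := p
    have hK : reflCoeff W c (t⁻¹ * s * t) = reflCoeff W c s := by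
      simpa using reflCoeff_conj hc s t⁻¹
    change MonoidAlgebra.single (t * (t⁻¹ * s * t)) (reflCoeff W c t *
      reflCoeff W c (t⁻¹ * s * t) * (wedge (α t) (α (t⁻¹ * s * t)) y y' /
        wedge (α t) (α (t⁻¹ * s * t)) v z)) = MonoidAlgebra.single (s * t)
      (reflCoeff W c s * reflCoeff W c t * (wedge (α s) (α t) y y' / wedge (α s) (α t) v z))
    rw [hK, mul_comm (reflCoeff W c t), show t * (t⁻¹ * s * t) = s * t by group]
    by_cases h0 : reflCoeff W c s * reflCoeff W c t = 0
    · rw [h0, zero_mul, zero_mul]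
    have hs := isReflection_of_reflCoeff_ne_zero (left_ne_zero_of_mul h0)
    have ht := isReflection_of_reflCoeff_ne_zero (right_ne_zero_of_mul h0)
    have hs' := isReflection_of_reflCoeff_ne_zero (hK.trans_ne (left_ne_zero_of_mul h0))
    obtain ⟨μ, hμ, H⟩ := exists_wedge_eq_smul (a := α s) (b := α t) (a' := α (t⁻¹ * s * t))
      (t := (t : V ≃ₗ[ℂ] V))
      (fun x hx => by rwa [← LinearMap.mem_ker, hα t ht, mem_ker_sub_id] at hx)
      (fun x hx => by
        rw [← LinearMap.mem_ker, hα s hs, mem_ker_sub_id] at hx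
        rw [← LinearMap.mem_ker, hα _ hs', mem_ker_sub_id]
        change (t : V ≃ₗ[ℂ] V).symm ((s : V ≃ₗ[ℂ] V) ((t : V ≃ₗ[ℂ] V) x)) = x
        rw [hx, LinearEquiv.symm_apply_apply])
      (fun h => hne _ hs' (by rw [h, LinearMap.zero_apply]))
    rw [H, H, mul_div_mul_left _ _ hμ]
  rw [← sub_eq_zero, gaudin_mul_sub_mul,
    ← sum_sub_smul_eq_zero_of_hurwitzMove F hF fun s => α s z / α s v]
  refine Finset.sum_congr rfl fun ⟨s, t⟩ _ => ?_
  simp only [F, MonoidAlgebra.smul_single, smul_eq_mul]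
  congr 1
  by_cases h0 : reflCoeff W c s * reflCoeff W c t = 0
  · rw [h0, zero_mul, zero_mul, mul_zero]
  have hs := hne s (isReflection_of_reflCoeff_ne_zero (left_ne_zero_of_mul h0))
  have ht := hne t (isReflection_of_reflCoeff_ne_zero (right_ne_zero_of_mul h0))
  by_cases hw : wedge (α s) (α t) v z = 0
  · simp [wedge_eq_zero hs (hz s t hw)]
  have hE : α t z / α t v - α s z / α s v = wedge (α s) (α t) v z / (α s v * α t v) := by
    simp only [wedge, LinearMap.sub_apply, LinearMap.smul_apply, smul_eq_mul]
    field_simp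
  rw [hE]
  field_simp
end
end
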